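/- Let d ≥ 1, let A ⊂ ℤ^d be a finite nonempty set and fix a_0 ∈ A. Then for every integer N ≥ (d·|A|·w(A))^{13·d^6}, the structure equation (∗) holds: NA = (N·H(A) ∩ (N·a_0 + Λ_{A−A})) ∖ ⋃_{a ∈ ex(H(A))} (N·a − E(a−A)). -/

import Mathlib

open Pointwise MeasureTheory

noncomputable section

/-- Embedding of integer vectors into real vectors. -/
def emb (d : ℕ) : (Fin d → ℤ) → (Fin d → ℝ) := fun x i => (x i : ℝ)

/-- The `N`-fold sumset `NA` (with `0·A = {0}`). -/
def nfold (d : ℕ) (A : Set (Fin d → ℤ)) (N : ℕ) : Set (Fin d → ℤ) :=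
  {x | ∃ f : Fin N → (Fin d → ℤ), (∀ i, f i ∈ A) ∧ x = ∑ i, f i}

/-- `P(A) = ⋃_{N ≥ 1} NA`. -/
def PA (d : ℕ) (A : Set (Fin d → ℤ)) : Set (Fin d → ℤ) :=
  ⋃ N ∈ Set.Ici 1, nfold d A N

/-- The width `w(A) = max_{a₁,a₂ ∈ A} ‖a₁ - a₂‖_∞`. -/
def width (d : ℕ) (A : Finset (Fin d → ℤ)) : ℕ :=
  (A ×ˢ A).sup fun p => Finset.univ.sup fun i => (p.1 i - p.2 i).natAbs

/-- The convex hull `H(A)` in `ℝ^d`. -/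
def hull (d : ℕ) (A : Finset (Fin d → ℤ)) : Set (Fin d → ℝ) :=
  convexHull ℝ (emb d '' ↑A)

/-- The cone `C_B = {∑_{b ∈ B} c_b b : c_b ≥ 0}` generated by `B`. -/
def cone (d : ℕ) (B : Finset (Fin d → ℤ)) : Set (Fin d → ℝ) :=
  {x | ∃ c : (Fin d → ℤ) → ℝ, (∀ a, 0 ≤ c a) ∧ x = ∑ a ∈ B, c a • emb d a}

/-- The lattice (subgroup of `ℤ^d`) generated by a set `S`. -/
def latt (d : ℕ) (S : Set (Fin d → ℤ)) : AddSubgroup (Fin d → ℤ) :=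
  AddSubgroup.closure S

/-- The exceptional set `E(A) = (C_A ∩ Λ_A) ∖ P(A)`, viewed inside `ℤ^d`. -/
def excep (d : ℕ) (A : Finset (Fin d → ℤ)) : Set (Fin d → ℤ) :=
  {x | emb d x ∈ cone d A ∧ x ∈ latt d ↑A ∧ x ∉ PA d ↑A}

/-- The set of (lattice) extreme points of `H(A)`: those `p` with `emb p ∈ H(A)` such that
some `v ∈ span ℝ (A - A)`, `v ≠ 0`, satisfies `⟨v,x⟩ > ⟨v,p⟩` for all `x ∈ H(A) ∖ {p}`. -/
def exP (d : ℕ) (A : Finset (Fin d → ℤ)) : Set (Fin d → ℤ) :=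
  {p | emb d p ∈ hull d A ∧
    ∃ v ∈ Submodule.span ℝ (emb d '' ((A : Set (Fin d → ℤ)) - (A : Set (Fin d → ℤ)))),
      v ≠ (0 : Fin d → ℝ) ∧
      ∀ x ∈ hull d A, x ≠ emb d p → (∑ i, v i * emb d p i) < ∑ i, v i * x i}

/-- The structure equation
`NA = (N·H(A) ∩ (N·a₀ + Λ_{A-A})) ∖ ⋃_{a ∈ ex(H(A))} (N·a - E(a - A))`. -/
def structEq (d : ℕ) (A : Finset (Fin d → ℤ)) (a0 : Fin d → ℤ) (N : ℕ) : Prop :=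
  emb d '' nfold d ↑A N =
    ((N : ℝ) • hull d A ∩
      emb d '' (({N • a0} : Set (Fin d → ℤ)) +
        (latt d ((A : Set (Fin d → ℤ)) - (A : Set (Fin d → ℤ))) : Set (Fin d → ℤ)))) \
    ⋃ a ∈ exP d A,
      emb d '' (({N • a} : Set (Fin d → ℤ)) - excep d (A.image fun y => a - y))

/-- `H(A)` is a `d`-simplex: there is `B ⊆ A` with `|B| = d+1`, `B - B` spanning `ℝ^d`,
and `H(A) = H(B)`. -/
def IsSimplex (d : ℕ) (A : Finset (Fin d → ℤ)) : Prop :=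
  ∃ B ⊆ A, B.card = d + 1 ∧
    Submodule.span ℝ (emb d '' ((B : Set (Fin d → ℤ)) - (B : Set (Fin d → ℤ)))) = ⊤ ∧
    hull d B = hull d A

/-- `N_A(v)`: the minimal positive `N` with `v ∈ NA`, and `N_A(0) = 0`. -/
def NAfn (d : ℕ) (A : Set (Fin d → ℤ)) (v : Fin d → ℤ) : ℕ :=
  if v = 0 then 0 else sInf {N : ℕ | 0 < N ∧ v ∈ nfold d A N}

/-- The set `S(A,B)` of `B`-minimal elements. -/
def Smin (d : ℕ) (A B : Set (Fin d → ℤ)) : Set (Fin d → ℤ) :=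
  {0} ∪ {u | u ∈ PA d A ∧ u ≠ 0 ∧
    ∀ f : Fin (NAfn d A u) → (Fin d → ℤ), (∀ i, f i ∈ A) → u = ∑ i, f i →
      ∀ i, f i ∉ B ∪ ({0} : Set (Fin d → ℤ))}

/-- A nonnegative real relation with a large coefficient dominates a nonzero integral one. -/
lemma exists_nat_relation_le {ι : Type*} {d : ℕ} (S : Finset ι) (u : ι → Fin d → ℤ) (W : ℕ)
    (hu : ∀ s ∈ S, ∀ i, |u s i| ≤ W) (w : ι → ℝ) (hw : ∀ s, 0 ≤ w s)
    (hrel : ∀ i, ∑ s ∈ S, w s * (u s i : ℝ) = 0) (s₀ : ι)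
    (hs₀ : (((2 * (S.card * W) + 1) ^ d : ℕ) : ℝ) ≤ w s₀) :
    ∃ g : ι → ℤ, (∀ s, 0 ≤ g s) ∧ (∀ s, (g s : ℝ) ≤ w s) ∧ 0 < g s₀ ∧
      ∀ i, ∑ s ∈ S, g s * u s i = 0 := by
  classical
  set Q : ℕ := (2 * (S.card * W) + 1) ^ d with hQ
  have hQpos : (0 : ℝ) < Q := by rw [hQ]; positivity
  let F : ℕ → ι → ℤ := fun t s => ⌊(t : ℝ) * (w s / Q)⌋
  let φ : ℕ → Fin d → ℤ := fun t i => ∑ s ∈ S, F t s * u s i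
  let R : ℤ := ((S.card * W : ℕ) : ℤ)
  have hbox : ∀ t ∈ Finset.range (Q + 1),
      φ t ∈ Fintype.piFinset (fun _ : Fin d => Finset.Icc (-R) R) := by
    intro t _
    rw [Fintype.mem_piFinset]
    intro i
    rw [Finset.mem_Icc, ← abs_le]
    have h1 : ((φ t i : ℤ) : ℝ) = -∑ s ∈ S, Int.fract ((t : ℝ) * (w s / Q)) * (u s i : ℝ) := by
      have h2 : ∑ s ∈ S, ((t : ℝ) * (w s / Q)) * (u s i : ℝ) = 0 := by
        have := congrArg (fun x => (t : ℝ) / Q * x) (hrel i)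
        simp only [mul_zero, Finset.mul_sum] at this
        rw [← this]
        exact Finset.sum_congr rfl fun s _ => by ring
      rw [eq_neg_iff_add_eq_zero, ← h2]
      simp only [φ, F]
      push_cast
      rw [← Finset.sum_add_distrib]
      refine Finset.sum_congr rfl fun s _ => ?_
      rw [← add_mul, Int.floor_add_fract]
    have h3 : |((φ t i : ℤ) : ℝ)| ≤ ((S.card * W : ℕ) : ℝ) := by
      rw [h1, abs_neg]
      refine (Finset.abs_sum_le_sum_abs _ _).trans ?_
      push_cast
      rw [← nsmul_eq_mul]
      refine Finset.sum_le_card_nsmul _ _ _ fun s hs => ?_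
      rw [abs_mul, abs_of_nonneg (Int.fract_nonneg _)]
      have h4 : |(u s i : ℝ)| ≤ W := by exact_mod_cast hu s hs i
      calc _ ≤ 1 * |(u s i : ℝ)| :=
            mul_le_mul_of_nonneg_right (Int.fract_lt_one _).le (abs_nonneg _)
        _ ≤ W := by rwa [one_mul]
    exact_mod_cast h3
  have hcard : (Fintype.piFinset (fun _ : Fin d => Finset.Icc (-R) R)).card
      < (Finset.range (Q + 1)).card := by
    rw [Fintype.card_piFinset_const, Int.card_Icc, Finset.card_range]
    have : (R + 1 - -R).toNat = 2 * (S.card * W) + 1 := by omega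
    rw [this, ← hQ]
    exact Nat.lt_succ_self _
  obtain ⟨t, ht, t', ht', hne, heq⟩ :=
    Finset.exists_ne_map_eq_of_card_lt_of_maps_to hcard hbox
  wlog hlt : t < t' generalizing t t'
  · exact this t' ht' t ht hne.symm heq.symm (lt_of_le_of_ne (not_lt.1 hlt) hne.symm)
  have hq : ∀ s, 0 ≤ w s / Q := fun s => div_nonneg (hw s) hQpos.le
  have ht'Q : (t' : ℝ) ≤ Q := by
    exact_mod_cast Nat.lt_succ_iff.1 (Finset.mem_range.1 ht')
  have hlt' : (t : ℝ) + 1 ≤ t' := by exact_mod_cast hlt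
  refine ⟨fun s => F t' s - F t s, fun s => ?_, fun s => ?_, ?_, fun i => ?_⟩
  · exact sub_nonneg.2 (Int.floor_le_floor (mul_le_mul_of_nonneg_right (by linarith) (hq s)))
  · have h0 : (0 : ℝ) ≤ F t s := by
      exact_mod_cast Int.floor_nonneg.2 (mul_nonneg t.cast_nonneg (hq s))
    have h1 : (F t' s : ℝ) ≤ t' * (w s / Q) := Int.floor_le _
    have h2 : (t' : ℝ) * (w s / Q) ≤ Q * (w s / Q) := mul_le_mul_of_nonneg_right ht'Q (hq s)
    rw [mul_div_cancel₀ _ hQpos.ne'] at h2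
    push_cast
    linarith
  · have h1 : 1 ≤ w s₀ / Q := (one_le_div hQpos).2 hs₀
    have h2 : F t s₀ + 1 ≤ F t' s₀ := by
      rw [← Int.floor_add_one]
      exact Int.floor_le_floor (by nlinarith)
    show 0 < F t' s₀ - F t s₀
    omega
  · simp only [sub_mul, Finset.sum_sub_distrib]
    exact sub_eq_zero.2 (congrFun heq i).symm

/-- Proximity: if a system with nonnegative real solution `y` has a nonnegative integral solution,
then it has one which exceeds `y` by a bounded amount only. -/
lemma exists_int_solution_near {ι : Type*} {d : ℕ} (S : Finset ι) (u : ι → Fin d → ℤ) (W : ℕ)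
    (hu : ∀ s ∈ S, ∀ i, |u s i| ≤ W) (y : ι → ℝ) (hy : ∀ s, 0 ≤ y s)
    (z : ι → ℤ) (hz : ∀ s, 0 ≤ z s)
    (hyz : ∀ i, ∑ s ∈ S, y s * (u s i : ℝ) = ∑ s ∈ S, (z s : ℝ) * (u s i : ℝ)) :
    ∃ z' : ι → ℤ, (∀ s, 0 ≤ z' s) ∧
      (∀ i, ∑ s ∈ S, z' s * u s i = ∑ s ∈ S, z s * u s i) ∧
      ∀ s ∈ S, (z' s : ℝ) ≤ y s + ((2 * (S.card * W) + 1) ^ d : ℕ) := by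
  classical
  induction hn : ⌊∑ s ∈ S, |(z s : ℝ) - y s|⌋₊ using Nat.strong_induction_on generalizing z with
  | _ n ih =>
  by_cases hsmall : ∀ s ∈ S, (z s : ℝ) ≤ y s + ((2 * (S.card * W) + 1) ^ d : ℕ)
  · exact ⟨z, hz, fun _ => rfl, hsmall⟩
  push Not at hsmall
  obtain ⟨s₀, hs₀, hbig⟩ := hsmall
  let ε : ι → ℤ := fun s => if y s ≤ z s then 1 else -1
  have hε : ∀ s, |ε s| = 1 := fun s => by simp only [ε]; split_ifs <;> simp
  have hεabs : ∀ s, |(z s : ℝ) - y s| * ε s = z s - y s := fun s => by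
    simp only [ε]
    split_ifs with h
    · rw [abs_of_nonneg (by linarith)]; simp
    · rw [abs_of_nonpos (by linarith)]; simp
  obtain ⟨g, hg0, hgle, hgpos, hgrel⟩ := exists_nat_relation_le S (fun s i => ε s * u s i) W
    (fun s hs i => by rw [abs_mul, hε, one_mul]; exact hu s hs i)
    (fun s => |(z s : ℝ) - y s|) (fun s => abs_nonneg _)
    (fun i => by
      have h1 : ∀ s ∈ S, |(z s : ℝ) - y s| * ((ε s * u s i : ℤ) : ℝ) =
          (z s : ℝ) * u s i - y s * u s i := fun s _ => by
        push_cast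
        rw [← mul_assoc, hεabs, sub_mul]
      rw [Finset.sum_congr rfl h1, Finset.sum_sub_distrib, hyz i, sub_self])
    s₀ (le_trans (by linarith) (le_abs_self _))
  let z₁ : ι → ℤ := fun s => z s - ε s * g s
  have hz₁abs : ∀ s, |(z₁ s : ℝ) - y s| = |(z s : ℝ) - y s| - g s := fun s => by
    have h1 := hgle s
    simp only [z₁, ε]
    split_ifs with h
    · rw [abs_of_nonneg (by linarith : 0 ≤ (z s : ℝ) - y s)] at h1 ⊢
      push_cast
      rw [abs_of_nonneg (by linarith)]
      ring
    · rw [abs_of_nonpos (by linarith : (z s : ℝ) - y s ≤ 0)] at h1 ⊢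
      push_cast
      rw [abs_of_nonpos (by linarith)]
      ring
  have hz₁0 : ∀ s, 0 ≤ z₁ s := fun s => by
    have h1 := hgle s
    have h2 := hy s
    have h3 := hg0 s
    have h4 := hz s
    simp only [z₁, ε]
    split_ifs with h
    · rw [abs_of_nonneg (by linarith : 0 ≤ (z s : ℝ) - y s)] at h1
      have : (0 : ℝ) ≤ z s - g s := by linarith
      have : 0 ≤ z s - g s := by exact_mod_cast this
      linarith
    · linarith
  have hz₁sum : ∀ i, ∑ s ∈ S, z₁ s * u s i = ∑ s ∈ S, z s * u s i := fun i => by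
    have h1 : ∀ s ∈ S, z₁ s * u s i = z s * u s i - g s * (ε s * u s i) := fun s _ => by
      simp only [z₁]; ring
    rw [Finset.sum_congr rfl h1, Finset.sum_sub_distrib, hgrel i, sub_zero]
  have hdec : ∑ s ∈ S, |(z₁ s : ℝ) - y s| + 1 ≤ ∑ s ∈ S, |(z s : ℝ) - y s| := by
    simp only [hz₁abs, Finset.sum_sub_distrib]
    have h1 : (g s₀ : ℝ) ≤ ∑ s ∈ S, (g s : ℝ) :=
      Finset.single_le_sum (f := fun s => (g s : ℝ)) (fun s _ => by exact_mod_cast hg0 s) hs₀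
    have h2 : (1 : ℝ) ≤ g s₀ := by exact_mod_cast hgpos
    linarith
  have hlt : ⌊∑ s ∈ S, |(z₁ s : ℝ) - y s|⌋₊ < n := by
    rw [← hn, ← Nat.succ_le_iff, Nat.succ_eq_add_one,
      ← Nat.floor_add_one (Finset.sum_nonneg fun s _ => abs_nonneg _)]
    exact Nat.floor_le_floor hdec
  obtain ⟨z', h1, h2, h3⟩ := ih _ hlt z₁ hz₁0 (fun i => by
    rw [hyz i]; exact_mod_cast (hz₁sum i).symm) rfl
  exact ⟨z', h1, fun i => (h2 i).trans (hz₁sum i), h3⟩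

lemma mem_nfold_iff {d : ℕ} (A : Finset (Fin d → ℤ)) (N : ℕ) (x : Fin d → ℤ) :
    x ∈ nfold d ↑A N ↔
      ∃ z : (Fin d → ℤ) → ℕ, ∑ a ∈ A, z a = N ∧ x = ∑ a ∈ A, z a • a := by
  classical
  constructor
  · rintro ⟨f, hf, rfl⟩
    refine ⟨fun a => (Finset.univ.filter fun i => f i = a).card, ?_, ?_⟩
    · rw [← Finset.card_eq_sum_card_fiberwise (fun i _ => hf i), Finset.card_univ,
        Fintype.card_fin]
    · rw [← Finset.sum_fiberwise_of_maps_to (fun i _ => hf i)]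
      refine Finset.sum_congr rfl fun a _ => ?_
      rw [Finset.sum_congr rfl (fun i hi => (Finset.mem_filter.1 hi).2), Finset.sum_const]
  · rintro ⟨z, hz, rfl⟩
    induction N generalizing z with
    | zero =>
      refine ⟨Fin.elim0, fun i => i.elim0, ?_⟩
      rw [Finset.sum_eq_zero_iff] at hz
      simpa using Finset.sum_eq_zero fun a ha => by simp [hz a ha]
    | succ n ih =>
      obtain ⟨b, hb, hbz⟩ : ∃ b ∈ A, z b ≠ 0 := by
        by_contra! h
        rw [Finset.sum_eq_zero h] at hz
        omega
      have hz' : z = fun a => (z a - if a = b then 1 else 0) + if a = b then 1 else 0 := by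
        ext a
        split_ifs with h
        · subst h; omega
        · rfl
      have h1 : ∑ a ∈ A, (z a - if a = b then 1 else 0) = n := by
        rw [hz', Finset.sum_add_distrib, Finset.sum_ite_eq', if_pos hb] at hz
        omega
      obtain ⟨f, hf, hfx⟩ := ih _ h1
      refine ⟨Fin.cons b f, fun i => ?_, ?_⟩
      · refine Fin.cases ?_ (fun j => ?_) i
        · simpa using hb
        · simpa using hf j
      · rw [Fin.sum_cons, ← hfx]
        conv_lhs => rw [hz']
        simp only [add_smul, Finset.sum_add_distrib, ite_smul, one_smul, zero_smul]
        rw [Finset.sum_ite_eq', if_pos hb, add_comm]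

lemma emb_injective (d : ℕ) : Function.Injective (emb d) := fun x y h => by
  ext i
  have := congrFun h i
  simpa [emb] using this

lemma emb_sum_nsmul {d : ℕ} (A : Finset (Fin d → ℤ)) (z : (Fin d → ℤ) → ℕ) :
    emb d (∑ a ∈ A, z a • a) = ∑ a ∈ A, (z a : ℝ) • emb d a := by
  ext i
  simp [emb, Finset.sum_apply]

lemma hull_eq_sum {d : ℕ} (A : Finset (Fin d → ℤ)) (x : Fin d → ℝ) :
    x ∈ hull d A ↔ ∃ c : (Fin d → ℤ) → ℝ, (∀ a ∈ A, 0 ≤ c a) ∧ ∑ a ∈ A, c a = 1 ∧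
      x = ∑ a ∈ A, c a • emb d a := by
  classical
  unfold hull
  constructor
  · intro hx
    rw [← Finset.coe_image, Finset.mem_convexHull'] at hx
    obtain ⟨c, h0, h1, h2⟩ := hx
    rw [Finset.sum_image fun _ _ _ _ h => emb_injective d h] at h1 h2
    exact ⟨fun a => c (emb d a), fun a ha => h0 _ (Finset.mem_image_of_mem _ ha), h1, h2.symm⟩
  · rintro ⟨c, h0, h1, rfl⟩
    exact (convex_convexHull ℝ _).sum_mem h0 h1
      fun a ha => subset_convexHull ℝ _ (Set.mem_image_of_mem _ ha)

lemma nfold_subset_hull {d : ℕ} {A : Finset (Fin d → ℤ)} {a0 : Fin d → ℤ} (ha0 : a0 ∈ A)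
    (N : ℕ) : emb d '' nfold d ↑A N ⊆ (N : ℝ) • hull d A := by
  rintro _ ⟨x, hx, rfl⟩
  obtain ⟨z, hz, rfl⟩ := (mem_nfold_iff A N x).1 hx
  have hzR : ∑ a ∈ A, (z a : ℝ) = N := by exact_mod_cast hz
  rcases Nat.eq_zero_or_pos N with rfl | hN
  · refine ⟨emb d a0, subset_convexHull ℝ _ (Set.mem_image_of_mem _ ha0), ?_⟩
    rw [Finset.sum_eq_zero_iff] at hz
    rw [emb_sum_nsmul, Finset.sum_eq_zero fun a ha => by rw [hz a ha]; simp]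
    simp
  · have hN' : (N : ℝ) ≠ 0 := by positivity
    refine ⟨∑ a ∈ A, ((z a : ℝ) / N) • emb d a, (hull_eq_sum A _).2
      ⟨_, fun a _ => by positivity, ?_, rfl⟩, ?_⟩
    · rw [← Finset.sum_div, hzR, div_self hN']
    · rw [emb_sum_nsmul]
      simp only [Finset.smul_sum, smul_smul, mul_div_cancel₀ _ hN']

lemma nfold_subset_coset {d : ℕ} {A : Finset (Fin d → ℤ)} {a0 : Fin d → ℤ} (ha0 : a0 ∈ A)
    (N : ℕ) : nfold d ↑A N ⊆ ({N • a0} : Set (Fin d → ℤ)) +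
      (latt d ((A : Set (Fin d → ℤ)) - (A : Set (Fin d → ℤ))) : Set (Fin d → ℤ)) := by
  rintro _ ⟨f, hf, rfl⟩
  refine Set.mem_add.2 ⟨_, rfl, ∑ i, (f i - a0), ?_, ?_⟩
  · exact sum_mem fun i _ => AddSubgroup.subset_closure (Set.sub_mem_sub (hf i) ha0)
  · simp [Finset.sum_sub_distrib]

lemma nfold_disjoint_excep {d : ℕ} (A : Finset (Fin d → ℤ)) (a : Fin d → ℤ) {N : ℕ}
    (hN : 1 ≤ N) {x : Fin d → ℤ} (hx : x ∈ nfold d ↑A N) :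
    emb d x ∉ emb d '' (({N • a} : Set (Fin d → ℤ)) - excep d (A.image fun y => a - y)) := by
  rintro ⟨x', hx', h⟩
  obtain rfl := emb_injective d h
  obtain ⟨_, rfl, e, ⟨_, _, he⟩, rfl⟩ := Set.mem_sub.1 hx'
  obtain ⟨f, hf, hfx⟩ := hx
  refine he (Set.mem_biUnion (Set.mem_Ici.2 hN) ⟨fun i => a - f i, fun i => ?_, ?_⟩)
  · exact Finset.mem_coe.2 (Finset.mem_image_of_mem _ (hf i))
  · rw [Finset.sum_sub_distrib, ← hfx]
    simp

/-- A linear functional is represented on a subspace by a vector of that subspace. -/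
lemma exists_mem_dot_eq {d : ℕ} (V : Submodule ℝ (Fin d → ℝ)) (f : (Fin d → ℝ) →ₗ[ℝ] ℝ) :
    ∃ v ∈ V, ∀ x ∈ V, ∑ i, v i * x i = f x := by
  let e : EuclideanSpace ℝ (Fin d) ≃ₗ[ℝ] (Fin d → ℝ) := WithLp.linearEquiv 2 ℝ (Fin d → ℝ)
  let V' : Submodule ℝ (EuclideanSpace ℝ (Fin d)) := V.comap e.toLinearMap
  let φ : V' →ₗ[ℝ] ℝ := f ∘ₗ e.toLinearMap ∘ₗ V'.subtype
  let ψ : StrongDual ℝ V' := LinearMap.toContinuousLinearMap φ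
  let r : V' := (InnerProductSpace.toDual ℝ V').symm ψ
  refine ⟨e r, r.2, fun x hx => ?_⟩
  have hx' : e.symm x ∈ V' := by simpa [V'] using hx
  have h := InnerProductSpace.toDual_symm_apply (x := (⟨e.symm x, hx'⟩ : V'))
    (y := ψ)
  have h2 : ψ ⟨e.symm x, hx'⟩ = f x := by
    simp [ψ, φ]
  rw [h2, Submodule.coe_inner, PiLp.inner_apply] at h
  rw [← h]
  refine Finset.sum_congr rfl fun i _ => ?_
  simp [e, r, mul_comm]

/-- A polytope with at least two vertices is the convex hull of some of its exposed points. -/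
lemma exists_subset_exP {d : ℕ} {A : Finset (Fin d → ℤ)} (hA : 2 ≤ A.card) :
    ∃ B ⊆ A, hull d A ⊆ hull d B ∧ ∀ b ∈ B, b ∈ exP d A := by
  classical
  obtain ⟨B, hB, hmin⟩ := (A.powerset.filter fun B => hull d A ⊆ hull d B).exists_min_image
    Finset.card ⟨A, by simp⟩
  simp only [Finset.mem_filter, Finset.mem_powerset] at hB hmin
  obtain ⟨hBA, hAB⟩ := hB
  have hBA' : hull d B ⊆ hull d A := convexHull_mono (Set.image_mono (by exact_mod_cast hBA))
  refine ⟨B, hBA, hAB, fun b hb => ?_⟩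
  have hbA : emb d b ∈ hull d A := subset_convexHull ℝ _ (Set.mem_image_of_mem _ (hBA hb))
  have hnot : emb d b ∉ hull d (B.erase b) := fun h => by
    have h1 : hull d B ⊆ hull d (B.erase b) := by
      refine convexHull_min ?_ (convex_convexHull ℝ _)
      rintro _ ⟨c, hc, rfl⟩
      by_cases hcb : c = b
      · rwa [hcb]
      · exact subset_convexHull ℝ _ ⟨c, by simpa [hcb] using hc, rfl⟩
    have h2 := hmin (B.erase b) ⟨(Finset.erase_subset _ _).trans hBA, hAB.trans h1⟩
    exact absurd (Finset.card_erase_lt_of_mem hb) (not_lt.2 h2)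
  obtain ⟨f, t, hfb, hft⟩ := geometric_hahn_banach_point_closed
    (convex_convexHull ℝ (emb d '' ↑(B.erase b)))
    (((B.erase b).finite_toSet.image _).isClosed_convexHull ℝ) hnot
  have hfstrict : ∀ x ∈ hull d A, x ≠ emb d b → f (emb d b) < f x := fun x hx hxb => by
    obtain ⟨c, hc0, hc1, rfl⟩ := (hull_eq_sum B x).1 (hAB hx)
    have hpos : ∀ a ∈ B, a ≠ b → f (emb d b) < f (emb d a) := fun a ha hab =>
      hfb.trans (hft _ (subset_convexHull ℝ _ ⟨a, by simp [hab, ha], rfl⟩))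
    have hex : ∃ a ∈ B, a ≠ b ∧ c a ≠ 0 := by
      by_contra! h
      refine hxb ?_
      have hcb : c b = 1 := by
        rw [← hc1, Finset.sum_eq_single_of_mem b hb fun a ha hab => h a ha hab]
      rw [Finset.sum_eq_single_of_mem b hb fun a ha hab => by rw [h a ha hab, zero_smul], hcb,
        one_smul]
    obtain ⟨a, ha, hab, hca⟩ := hex
    calc f (emb d b) = ∑ a ∈ B, c a * f (emb d b) := by rw [← Finset.sum_mul, hc1, one_mul]
      _ < ∑ a ∈ B, c a * f (emb d a) := by
          refine Finset.sum_lt_sum (fun a ha => ?_) ⟨a, ha, ?_⟩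
          · by_cases hab : a = b
            · rw [hab]
            · exact mul_le_mul_of_nonneg_left (hpos a ha hab).le (hc0 a ha)
          · exact mul_lt_mul_of_pos_left (hpos a ha hab)
              (lt_of_le_of_ne (hc0 a ha) (Ne.symm hca))
      _ = f (∑ a ∈ B, c a • emb d a) := by simp [map_sum]
  set V := Submodule.span ℝ (emb d '' ((A : Set (Fin d → ℤ)) - (A : Set (Fin d → ℤ)))) with hV
  obtain ⟨v, hvV, hv⟩ := exists_mem_dot_eq V (f : (Fin d → ℝ) →ₗ[ℝ] ℝ)
  have hdiff : ∀ x ∈ hull d A, x - emb d b ∈ V := fun x hx => by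
    obtain ⟨c, hc0, hc1, rfl⟩ := (hull_eq_sum A x).1 hx
    have h1 : ∑ a ∈ A, c a • emb d a - emb d b = ∑ a ∈ A, c a • emb d (a - b) := by
      have h2 : ∀ a ∈ A, c a • emb d (a - b) = c a • emb d a - c a • emb d b := fun a _ => by
        rw [← smul_sub]
        congr 1
        ext i
        simp [emb]
      rw [Finset.sum_congr rfl h2, Finset.sum_sub_distrib, ← Finset.sum_smul, hc1, one_smul]
    rw [h1]
    exact sum_mem fun a ha => V.smul_mem _ (Submodule.subset_span
      (Set.mem_image_of_mem _ (Set.sub_mem_sub ha (hBA hb))))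
  have hvstrict : ∀ x ∈ hull d A, x ≠ emb d b →
      (∑ i, v i * emb d b i) < ∑ i, v i * x i := fun x hx hxb => by
    have h1 := hv _ (hdiff x hx)
    have h2 := hfstrict x hx hxb
    simp only [Pi.sub_apply, mul_sub, Finset.sum_sub_distrib, map_sub] at h1
    simp only [ContinuousLinearMap.coe_coe] at h1
    linarith
  refine ⟨hbA, v, hvV, fun hv0 => ?_, hvstrict⟩
  obtain ⟨a, ha, hab⟩ := Finset.exists_mem_ne hA b
  have h1 := hvstrict (emb d a) (subset_convexHull ℝ _ (Set.mem_image_of_mem _ ha))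
    fun h => hab (emb_injective d h)
  simp [hv0] at h1

lemma abs_sub_le_width {d : ℕ} {A : Finset (Fin d → ℤ)} {a b : Fin d → ℤ} (ha : a ∈ A)
    (hb : b ∈ A) (i : Fin d) : |a i - b i| ≤ (width d A : ℤ) := by
  have h1 : (a i - b i).natAbs ≤ width d A :=
    (Finset.le_sup (f := fun i => (a i - b i).natAbs) (Finset.mem_univ i)).trans
      (Finset.le_sup (f := fun p : (Fin d → ℤ) × (Fin d → ℤ) =>
        Finset.univ.sup fun i => (p.1 i - p.2 i).natAbs) (Finset.mk_mem_product ha hb))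
  rw [Int.abs_eq_natAbs]
  exact_mod_cast h1

lemma one_le_width {d : ℕ} {A : Finset (Fin d → ℤ)} (hA : 2 ≤ A.card) : 1 ≤ width d A := by
  obtain ⟨a, ha, b, hb, hab⟩ := Finset.one_lt_card.1 hA
  by_contra! h
  refine hab (funext fun i => ?_)
  have h1 := abs_sub_le_width ha hb i
  have h2 : width d A = 0 := by omega
  rw [h2, Nat.cast_zero, abs_nonpos_iff] at h1
  omega

/-- The core estimate: an element of `P(b - A)` which is `N` times a convex combination putting
weight at least `1 / |A|` on `b` is an `N`-fold sum. -/
lemma mem_nfold_of_weight {d : ℕ} {A : Finset (Fin d → ℤ)} {b : Fin d → ℤ} (hb : b ∈ A) {N : ℕ}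
    (hN : A.card ^ 2 * (2 * (A.card * width d A) + 1) ^ d ≤ N) {c : (Fin d → ℤ) → ℝ}
    (hc0 : ∀ a, 0 ≤ c a) (hc1 : ∑ a ∈ A, c a = N) (hcb : (N : ℝ) ≤ A.card * c b)
    {x : Fin d → ℤ} (hx : emb d x = ∑ a ∈ A, c a • emb d a)
    (hP : N • b - x ∈ PA d ↑(A.image fun y => b - y)) : x ∈ nfold d ↑A N := by
  classical
  obtain ⟨M, -, hM⟩ := Set.mem_iUnion₂.1 hP
  obtain ⟨z, -, hz⟩ := (mem_nfold_iff _ M _).1 hM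
  rw [Finset.sum_image fun _ _ _ _ h => sub_right_injective h] at hz
  set Q : ℕ := (2 * (A.card * width d A) + 1) ^ d with hQ
  obtain ⟨z', hz'0, hz'sum, hz'le⟩ := exists_int_solution_near A (fun a => b - a) (width d A)
    (fun a ha i => abs_sub_le_width hb ha i) c hc0 (fun a => (z (b - a) : ℤ))
    (fun a => by positivity) (fun i => by
      have h1 : ((N • b - x) i : ℤ) = ∑ a ∈ A, (z (b - a) : ℤ) * (b - a) i := by
        rw [hz]; simp [Finset.sum_apply]
      have h2 : (((N • b - x) i : ℤ) : ℝ) = ∑ a ∈ A, c a * (((b - a) i : ℤ) : ℝ) := by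
        have h3 := congrFun hx i
        simp only [emb, Finset.sum_apply, Pi.smul_apply, smul_eq_mul] at h3
        simp only [Pi.sub_apply, nsmul_eq_mul, Pi.mul_apply, Pi.natCast_apply]
        push_cast
        simp only [mul_sub, Finset.sum_sub_distrib]
        rw [← Finset.sum_mul, hc1, ← h3]
      rw [← h2, h1]
      push_cast
      rfl)
  have hcard : (0 : ℝ) < A.card := by exact_mod_cast Finset.card_pos.2 ⟨b, hb⟩
  have hle : ∑ a ∈ A.erase b, z' a ≤ N := by
    have h1 : ∑ a ∈ A.erase b, (z' a : ℝ) ≤ ∑ a ∈ A.erase b, (c a + Q) :=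
      Finset.sum_le_sum fun a ha => hz'le a (Finset.mem_of_mem_erase ha)
    rw [Finset.sum_add_distrib, Finset.sum_const, nsmul_eq_mul] at h1
    have h2 := Finset.add_sum_erase A c hb
    have h3 : ((A.erase b).card : ℝ) * Q ≤ A.card * Q :=
      mul_le_mul_of_nonneg_right (by exact_mod_cast Finset.card_le_card (Finset.erase_subset _ _))
        (by positivity)
    have h4 : (A.card : ℝ) * Q ≤ c b := by
      refine le_of_mul_le_mul_left ?_ hcard
      have : (A.card : ℝ) ^ 2 * Q ≤ N := by exact_mod_cast hN
      nlinarith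
    have h5 : ∑ a ∈ A.erase b, (z' a : ℝ) ≤ N := by linarith
    exact_mod_cast h5
  let m : (Fin d → ℤ) → ℤ := fun a => if a = b then N - ∑ a ∈ A.erase b, z' a else z' a
  have hm0 : ∀ a, 0 ≤ m a := fun a => by
    simp only [m]
    split_ifs
    · linarith
    · exact hz'0 a
  have hmerase : ∀ a ∈ A.erase b, m a = z' a := fun a ha => if_neg (Finset.ne_of_mem_erase ha)
  have hmsum : ∑ a ∈ A, m a = N := by
    rw [← Finset.add_sum_erase A m hb, Finset.sum_congr rfl hmerase]
    simp [m]
  have hmx : ∀ i, x i = ∑ a ∈ A, m a * a i := fun i => by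
    have h1 : (N • b - x) i = ∑ a ∈ A, (z (b - a) : ℤ) * (b - a) i := by
      rw [hz]; simp [Finset.sum_apply]
    have h2 : ∑ a ∈ A, m a * (b - a) i = ∑ a ∈ A, z' a * (b - a) i := by
      refine Finset.sum_congr rfl fun a ha => ?_
      by_cases hab : a = b
      · simp [hab]
      · rw [hmerase a (Finset.mem_erase.2 ⟨hab, ha⟩)]
    have h3 := h1.trans ((hz'sum i).symm.trans h2.symm)
    simp only [Pi.sub_apply, nsmul_eq_mul, Pi.mul_apply, Pi.natCast_apply, mul_sub, Finset.sum_sub_distrib] at h3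
    rw [← Finset.sum_mul, hmsum] at h3
    linarith
  refine (mem_nfold_iff A N x).2 ⟨fun a => (m a).toNat, ?_, ?_⟩
  · zify
    simpa [hm0] using hmsum
  · ext i
    rw [hmx i]
    simp [Finset.sum_apply, hm0]

lemma card_sq_mul_le {d k w : ℕ} (hd : 1 ≤ d) (hk : 2 ≤ k) (hw : 1 ≤ w) :
    k ^ 2 * (2 * (k * w) + 1) ^ d ≤ (d * k * w) ^ (13 * d ^ 6) := by
  set X := d * k * w with hX
  have hkw : k * w ≤ X := by
    rw [hX, mul_assoc]; exact Nat.le_mul_of_pos_left _ hd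
  have hkX : k ≤ X := (Nat.le_mul_of_pos_right _ hw).trans hkw
  have hX2 : 2 ≤ X := hk.trans hkX
  have h3 : 2 * (k * w) + 1 ≤ X ^ 3 := by
    have : 2 * 2 * X ≤ X ^ 3 := by
      rw [pow_succ, sq]; exact Nat.mul_le_mul_right _ (Nat.mul_le_mul hX2 hX2)
    omega
  have hd6 : d ≤ d ^ 6 := Nat.le_self_pow (by norm_num) d
  calc k ^ 2 * (2 * (k * w) + 1) ^ d ≤ X ^ 2 * (X ^ 3) ^ d :=
        Nat.mul_le_mul (Nat.pow_le_pow_left hkX 2) (Nat.pow_le_pow_left h3 d)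
    _ = X ^ (2 + 3 * d) := by rw [← pow_mul, ← pow_add]
    _ ≤ X ^ (13 * d ^ 6) := Nat.pow_le_pow_right (by omega) (by omega)

lemma latt_sub_le {d : ℕ} (A : Finset (Fin d → ℤ)) (b : Fin d → ℤ) :
    latt d ((A : Set (Fin d → ℤ)) - (A : Set (Fin d → ℤ))) ≤
      latt d ↑(A.image fun y => b - y) := by
  refine (AddSubgroup.closure_le _).2 ?_
  rintro _ ⟨x, hx, y, hy, rfl⟩
  have h : ∀ a ∈ A, b - a ∈ latt d ↑(A.image fun y => b - y) := fun a ha =>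
    AddSubgroup.subset_closure (Finset.mem_coe.2 (Finset.mem_image_of_mem _ ha))
  have h1 := sub_mem (h y hy) (h x hx)
  rwa [sub_sub_sub_cancel_left] at h1

lemma structEq_of_card_sq_mul_le {d : ℕ} {A : Finset (Fin d → ℤ)} (hA : 2 ≤ A.card)
    {a0 : Fin d → ℤ} (ha0 : a0 ∈ A) {N : ℕ}
    (hN : A.card ^ 2 * (2 * (A.card * width d A) + 1) ^ d ≤ N) : structEq d A a0 N := by
  classical
  have hN1 : 1 ≤ N := le_trans (Nat.mul_pos (by positivity) (by positivity)) hN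
  refine Set.Subset.antisymm ?_ ?_
  · intro e he
    refine ⟨⟨nfold_subset_hull ha0 N he, Set.image_mono (nfold_subset_coset ha0 N) he⟩, ?_⟩
    obtain ⟨x, hx, rfl⟩ := he
    simp only [Set.mem_iUnion, not_exists]
    exact fun a _ => nfold_disjoint_excep A a hN1 hx
  · rintro _ ⟨⟨hH, x, hx, rfl⟩, hE⟩
    refine Set.mem_image_of_mem _ ?_
    obtain ⟨B, hBA, hAB, hB⟩ := exists_subset_exP hA
    obtain ⟨p, hp, hpx⟩ := hH
    obtain ⟨c, hc0, hc1, rfl⟩ := (hull_eq_sum B p).1 (hAB hp)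
    obtain ⟨b, hb, hcb⟩ : ∃ b ∈ B, 1 ≤ A.card * c b := by
      by_contra! h
      have hBne : B.Nonempty := by
        by_contra hne
        rw [Finset.not_nonempty_iff_eq_empty] at hne
        simp [hne] at hc1
      have h1 := Finset.sum_lt_sum_of_nonempty hBne h
      rw [← Finset.mul_sum, hc1] at h1
      rw [mul_one, Finset.sum_const, nsmul_one, Nat.cast_lt] at h1
      exact absurd (Finset.card_le_card hBA) (not_le.2 h1)
    let c' : (Fin d → ℤ) → ℝ := fun a => if a ∈ B then N * c a else 0
    have hc'0 : ∀ a, 0 ≤ c' a := fun a => by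
      simp only [c']
      split_ifs with h
      · exact mul_nonneg N.cast_nonneg (hc0 a h)
      · exact le_rfl
    have hc'1 : ∑ a ∈ A, c' a = N := by
      simp only [c']
      rw [← Finset.sum_filter, Finset.filter_mem_eq_inter, Finset.inter_eq_right.2 hBA,
        ← Finset.mul_sum, hc1, mul_one]
    have hc'x : emb d x = ∑ a ∈ A, c' a • emb d a := by
      simp only [c', ite_smul, zero_smul]
      rw [← Finset.sum_filter, Finset.filter_mem_eq_inter, Finset.inter_eq_right.2 hBA, ← hpx]
      simp only [Finset.smul_sum, smul_smul]
    have hc'b : (N : ℝ) ≤ A.card * c' b := by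
      simp only [c', if_pos hb]
      nlinarith [(N.cast_nonneg : (0 : ℝ) ≤ N)]
    refine mem_nfold_of_weight (hBA hb) hN hc'0 hc'1 hc'b hc'x ?_
    by_contra hP
    refine hE (Set.mem_biUnion (hB b hb) (Set.mem_image_of_mem _
      (Set.mem_sub.2 ⟨_, rfl, N • b - x, ⟨?_, ?_, hP⟩, sub_sub_cancel _ _⟩)))
    · refine ⟨fun a => c' (b - a), fun a => hc'0 _, ?_⟩
      rw [Finset.sum_image fun _ _ _ _ h => sub_right_injective h]
      ext i
      have h3 := congrFun hc'x i
      simp only [emb, Finset.sum_apply, Pi.smul_apply, smul_eq_mul] at h3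
      simp only [emb, Finset.sum_apply, Pi.smul_apply, smul_eq_mul, Pi.sub_apply, nsmul_eq_mul,
        Pi.mul_apply, Pi.natCast_apply, sub_sub_cancel]
      push_cast
      simp only [mul_sub, Finset.sum_sub_distrib]
      rw [← Finset.sum_mul, hc'1, ← h3]
    · obtain ⟨_, rfl, l, hl, rfl⟩ := Set.mem_add.1 hx
      have h1 : N • (b - a0) ∈ latt d ↑(A.image fun y => b - y) :=
        nsmul_mem (AddSubgroup.subset_closure
          (Finset.mem_coe.2 (Finset.mem_image_of_mem _ ha0))) N
      have h2 := sub_mem h1 (latt_sub_le A b hl)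
      rwa [smul_sub, sub_sub] at h2

lemma structEq_singleton {d : ℕ} (a0 : Fin d → ℤ) (N : ℕ) : structEq d {a0} a0 N := by
  refine Set.Subset.antisymm ?_ ?_
  · intro e he
    have ha0 := Finset.mem_singleton_self a0
    refine ⟨⟨nfold_subset_hull ha0 N he, Set.image_mono (nfold_subset_coset ha0 N) he⟩, ?_⟩
    simp only [Set.mem_iUnion, not_exists]
    rintro a ⟨_, v, hv, hv0, _⟩
    refine absurd ?_ hv0
    have h0 : emb d 0 = 0 := by ext i; simp [emb]
    simpa [h0] using hv
  · rintro _ ⟨⟨⟨p, hp, hpx⟩, x, -, rfl⟩, -⟩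
    refine ⟨x, ⟨fun _ => a0, fun _ => by simp, emb_injective d ?_⟩, rfl⟩
    have h1 : p = emb d a0 := by simpa [hull] using hp
    rw [← hpx, h1]
    ext i
    simp [emb]

/-- Effective structure theorem: the structure equation holds once
`N ≥ (d·|A|·w(A))^{13·d⁶}`. -/
theorem effective_structure (d : ℕ) (hd : 1 ≤ d)
    (A : Finset (Fin d → ℤ)) (hA : A.Nonempty)
    (a0 : Fin d → ℤ) (ha0 : a0 ∈ A) :
    ∀ N : ℕ, (d * A.card * width d A) ^ (13 * d ^ 6) ≤ N → structEq d A a0 N := by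
  intro N hN
  rcases Nat.lt_or_ge A.card 2 with h | h
  · have h1 : A.card = 1 := le_antisymm (by omega) (Finset.card_pos.2 hA)
    obtain ⟨a, rfl⟩ := Finset.card_eq_one.1 h1
    obtain rfl := Finset.mem_singleton.1 ha0
    exact structEq_singleton _ N
  · exact structEq_of_card_sq_mul_le h ha0 ((card_sq_mul_le hd h (one_le_width h)).trans hN)
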